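/- arXiv:2301.02570 — 3 statements merged into one kernel-verified Lean document; each statement's English description precedes it below -/
import Mathlib

section
/- Let G be a finite group and N a normal subgroup of index 2. Then m_2(G) equals the maximum of the set {m_2(N)} ∪ {1 + m_2(C_N(t)) : t is an involution of G not lying in N}, where C_N(t) denotes the centralizer of t in N. -/
/-- The `p`-rank of `G`: the largest `n` such that `G` has a subgroup
isomorphic to `(ℤ/pℤ)^n`. -/
noncomputable def pRank (p : ℕ) (G : Type*) [Group G] : ℕ :=
  sSup {n : ℕ | ∃ H : Subgroup G, Nonempty (H ≃* Multiplicative (Fin n → ZMod p))}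

/-- A finite group in which every square is trivial is a power of `ℤ/2ℤ`. -/
theorem exists_mulEquiv_of_sq_eq_one {A : Type*} [Group A] [Finite A]
    (hA : ∀ x : A, x ^ 2 = 1) :
    ∃ d : ℕ, Nonempty (A ≃* Multiplicative (Fin d → ZMod 2)) := by
  let : CommGroup A :=
    { mul_comm := Commute.of_orderOf_dvd_two fun x => orderOf_dvd_of_pow_eq_one (hA x) }
  let : Module (ZMod 2) (Additive A) := AddCommGroup.zmodModule (n := 2) fun x => hA x.toMul
  let e := (Module.finBasis (ZMod 2) (Additive A)).equivFun
  exact ⟨_, ⟨(MulEquiv.toAdditive (G := A) (H := Multiplicative _)).symm e.toAddEquiv⟩⟩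

theorem natCard_multiplicative_pi_zmod_two (n : ℕ) :
    Nat.card (Multiplicative (Fin n → ZMod 2)) = 2 ^ n := by
  rw [Nat.card_congr Multiplicative.toAdd, Nat.card_fun]
  simp

theorem bddAbove_elementaryAbelian_ranks (G : Type*) [Group G] [Finite G] :
    BddAbove {n : ℕ | ∃ H : Subgroup G, Nonempty (H ≃* Multiplicative (Fin n → ZMod 2))} := by
  refine ⟨Nat.card G, ?_⟩
  rintro n ⟨H, ⟨e⟩⟩
  calc n ≤ 2 ^ n := n.lt_two_pow_self.le
    _ = Nat.card H := by rw [Nat.card_congr e.toEquiv, natCard_multiplicative_pi_zmod_two]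
    _ ≤ Nat.card G := H.card_le_card_group

theorem le_pRank_two {G : Type*} [Group G] [Finite G] {H : Subgroup G} {n : ℕ}
    (hH : ∀ x ∈ H, x ^ 2 = 1) (hn : 2 ^ n ≤ Nat.card H) : n ≤ pRank 2 G := by
  obtain ⟨d, ⟨e⟩⟩ := exists_mulEquiv_of_sq_eq_one (A := H) fun x =>
    Subtype.ext (hH x x.2)
  have hd : Nat.card H = 2 ^ d := by
    rw [Nat.card_congr e.toEquiv, natCard_multiplicative_pi_zmod_two]
  have hnd : n ≤ d := (Nat.pow_le_pow_iff_right (by norm_num)).1 (hd ▸ hn)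
  exact hnd.trans (le_csSup (bddAbove_elementaryAbelian_ranks G) ⟨H, ⟨e⟩⟩)

theorem exists_subgroup_card_eq_two_pow_pRank (G : Type*) [Group G] [Finite G] :
    ∃ H : Subgroup G, (∀ x ∈ H, x ^ 2 = 1) ∧ Nat.card H = 2 ^ pRank 2 G := by
  have hne : {n : ℕ | ∃ H : Subgroup G,
      Nonempty (H ≃* Multiplicative (Fin n → ZMod 2))}.Nonempty := by
    obtain ⟨d, hd⟩ := exists_mulEquiv_of_sq_eq_one (A := (⊥ : Subgroup G)) fun x =>
      Subsingleton.elim _ _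
    exact ⟨d, ⊥, hd⟩
  obtain ⟨H, ⟨e⟩⟩ := Nat.sSup_mem hne (bddAbove_elementaryAbelian_ranks G)
  refine ⟨H, fun x hx => ?_, ?_⟩
  · have h : (⟨x, hx⟩ : H) ^ 2 = 1 := by
      apply e.injective
      rw [map_pow, map_one]
      apply Multiplicative.toAdd.injective
      rw [toAdd_pow, toAdd_one]
      ext i
      simp [CharTwo.two_eq_zero]
    exact congrArg Subtype.val h
  · rw [Nat.card_congr e.toEquiv, natCard_multiplicative_pi_zmod_two]
    rfl

theorem exists_le_subgroup_card_eq_two_pow_pRank {G : Type*} [Group G] [Finite G]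
    (K : Subgroup G) :
    ∃ H ≤ K, (∀ x ∈ H, x ^ 2 = 1) ∧ Nat.card H = 2 ^ pRank 2 K := by
  obtain ⟨H, hH, hcard⟩ := exists_subgroup_card_eq_two_pow_pRank K
  refine ⟨H.map K.subtype, Subgroup.map_subtype_le H, ?_, ?_⟩
  · rintro _ ⟨x, hx, rfl⟩
    rw [← map_pow, hH x hx, map_one]
  · rw [Subgroup.card_map_of_injective K.subtype_injective, hcard]

theorem le_pRank_two_of_le {G : Type*} [Group G] [Finite G] {H K : Subgroup G} {n : ℕ}
    (hHK : H ≤ K) (hH : ∀ x ∈ H, x ^ 2 = 1) (hn : 2 ^ n ≤ Nat.card H) : n ≤ pRank 2 K := by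
  refine le_pRank_two (H := H.subgroupOf K) (fun x hx => Subtype.ext (hH x hx)) ?_
  rwa [Nat.card_congr (Subgroup.subgroupOfEquivOfLe hHK).toEquiv]

theorem pRank_two_subgroup_le {G : Type*} [Group G] [Finite G] (K : Subgroup G) :
    pRank 2 K ≤ pRank 2 G := by
  obtain ⟨H, -, hH, hcard⟩ := exists_le_subgroup_card_eq_two_pow_pRank K
  exact le_pRank_two hH hcard.ge

theorem card_eq_two_mul_card_inf_of_index_two {G : Type*} [Group G]
    {N : Subgroup G} [N.Normal] (hidx : N.index = 2) {H : Subgroup G} (hH : ¬ H ≤ N) :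
    Nat.card H = 2 * Nat.card ↥(H ⊓ N) := by
  have hrel : N.relIndex H = 2 :=
    ((Nat.dvd_prime Nat.prime_two).1 (hidx ▸ N.relIndex_dvd_index_of_normal H)).resolve_left
      fun h => hH (Subgroup.relIndex_eq_one.1 h)
  have h := Subgroup.relIndex_mul_relIndex ⊥ (H ⊓ N) H bot_le inf_le_left
  rw [Subgroup.inf_relIndex_left, hrel, Subgroup.relIndex_bot_left,
    Subgroup.relIndex_bot_left] at h
  omega

theorem sq_eq_one_of_mem_closure {G : Type*} [Group G] {s : Set G}
    (hcomm : ∀ x ∈ s, ∀ y ∈ s, x * y = y * x) (hs : ∀ x ∈ s, x ^ 2 = 1)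
    {x : G} (hx : x ∈ Subgroup.closure s) : x ^ 2 = 1 := by
  have := Subgroup.isMulCommutative_closure hcomm
  induction hx using Subgroup.closure_induction with
  | mem x hx => exact hs x hx
  | one => exact one_pow 2
  | mul x y hx hy ihx ihy =>
    have hxy : Commute x y := setLike_mul_comm hx hy
    rw [hxy.mul_pow, ihx, ihy, one_mul]
  | inv x hx ih => rw [inv_pow, ih, inv_one]

theorem one_add_pRank_centralizer_le {G : Type*} [Group G] [Finite G]
    {N : Subgroup G} [N.Normal] (hidx : N.index = 2) {t : G} (ht : t ^ 2 = 1) (htN : t ∉ N) :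
    1 + pRank 2 ↥(Subgroup.centralizer {t} ⊓ N) ≤ pRank 2 G := by
  obtain ⟨E, hE, hsq, hcard⟩ :=
    exists_le_subgroup_card_eq_two_pow_pRank (Subgroup.centralizer {t} ⊓ N)
  have hcommE : ∀ x ∈ E, ∀ y ∈ E, x * y = y * x := fun x hx y hy =>
    congrArg Subtype.val (Commute.of_orderOf_dvd_two
      (fun z : E => orderOf_dvd_of_pow_eq_one (Subtype.ext (hsq z z.2))) ⟨x, hx⟩ ⟨y, hy⟩).eq
  have hcommt : ∀ x ∈ E, t * x = x * t := fun x hx =>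
    Subgroup.mem_centralizer_iff.1 (hE hx).1 t rfl
  have htF : t ∈ Subgroup.closure (insert t (E : Set G)) :=
    Subgroup.subset_closure (Set.mem_insert _ _)
  have hEF : E ≤ Subgroup.closure (insert t (E : Set G)) := fun x hx =>
    Subgroup.subset_closure (Set.mem_insert_of_mem _ hx)
  refine le_pRank_two (H := Subgroup.closure (insert t (E : Set G)))
    (fun z hz => sq_eq_one_of_mem_closure ?_ ?_ hz) ?_
  · rintro x (rfl | hx) y (rfl | hy)
    · rfl
    · exact hcommt y hy
    · exact (hcommt x hx).symm
    · exact hcommE x hx y hy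
  · rintro x (rfl | hx)
    · exact ht
    · exact hsq x hx
  · rw [card_eq_two_mul_card_inf_of_index_two hidx fun h => htN (h htF), pow_add, pow_one,
      ← hcard]
    exact Nat.mul_le_mul_left 2 (Subgroup.card_le_of_le (le_inf hEF (hE.trans inf_le_right)))

/-- If `N` is a normal subgroup of index `2` in a finite group `G`, then the `2`-rank of
`G` is the maximum of the set `{m_2(N)} ∪ {1 + m_2(C_N(t)) : t an involution of G, t ∉ N}`. -/
theorem pRank_index_two (G : Type*) [Group G] [Finite G]
    (N : Subgroup G) [N.Normal] (hidx : N.index = 2) :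
    pRank 2 G = sSup ({pRank 2 N} ∪
      {m : ℕ | ∃ t : G, orderOf t = 2 ∧ t ∉ N ∧
        m = 1 + pRank 2 ↥(Subgroup.centralizer {t} ⊓ N)}) := by
  refine (IsGreatest.csSup_eq ⟨?_, ?_⟩).symm
  · obtain ⟨H, hsq, hcard⟩ := exists_subgroup_card_eq_two_pow_pRank G
    by_cases hHN : H ≤ N
    · exact Or.inl (le_antisymm (le_pRank_two_of_le hHN hsq hcard.ge) (pRank_two_subgroup_le N))
    · obtain ⟨t, htH, htN⟩ := SetLike.not_le_iff_exists.1 hHN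
      refine Or.inr ⟨t, orderOf_eq_prime (hsq t htH) fun h => htN (h ▸ N.one_mem), htN,
        le_antisymm ?_ (one_add_pRank_centralizer_le hidx (hsq t htH) htN)⟩
      have hcent : H ⊓ N ≤ Subgroup.centralizer {t} ⊓ N := by
        refine le_inf (fun x hx => Subgroup.mem_centralizer_singleton_iff.2 ?_) inf_le_right
        exact congrArg Subtype.val (Commute.of_orderOf_dvd_two
          (fun z : H => orderOf_dvd_of_pow_eq_one (Subtype.ext (hsq z z.2)))
          ⟨x, hx.1⟩ ⟨t, htH⟩).eq
      have hcardN := card_eq_two_mul_card_inf_of_index_two hidx hHN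
      rw [hcard] at hcardN
      rw [add_comm, ← Nat.sub_le_iff_le_add]
      refine le_pRank_two_of_le hcent (fun x hx => hsq x hx.1) ?_
      rcases h : pRank 2 G with _ | k
      · exact Nat.card_pos
      · rw [h, pow_succ] at hcardN
        rw [Nat.add_sub_cancel]
        omega
  · rintro m (rfl | ⟨t, ht, htN, rfl⟩)
    · exact pRank_two_subgroup_le N
    · exact one_add_pRank_centralizer_le hidx (ht ▸ pow_orderOf_eq_one t) htN
end

section
/- Let q be an odd prime power. Then the number of Klein four-subgroups of PSL_2(q) is q(q²-1)/24. -/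
/-- `PGL₂(F)`: the quotient of `GL(2,F)` by its center. -/
abbrev PGL2 (F : Type*) [Field F] :=
  Matrix.GeneralLinearGroup (Fin 2) F ⧸ Subgroup.center (Matrix.GeneralLinearGroup (Fin 2) F)

/-- `PSL₂(F)`: the image of `SL(2,F)` in `PGL₂(F)` under the natural map. -/
def PSL2 (F : Type*) [Field F] : Subgroup (PGL2 F) :=
  ((QuotientGroup.mk' (Subgroup.center (Matrix.GeneralLinearGroup (Fin 2) F))).comp
    Matrix.SpecialLinearGroup.toGL).range

/-- The ordered pairs of distinct commuting involutions of a group. -/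
def commutingInvolutionPairs (G : Type*) [Group G] : Set (G × G) :=
  {p | p.1 ≠ 1 ∧ p.2 ≠ 1 ∧ p.1 ≠ p.2 ∧ p.1 * p.1 = 1 ∧ p.2 * p.2 = 1 ∧ p.1 * p.2 = p.2 * p.1}

/-- The ordered pairs of distinct nonidentity elements of a group. -/
abbrev NontrivialPairs (G : Type*) [Group G] : Type _ :=
  {p : G × G // p.1 ≠ 1 ∧ p.2 ≠ 1 ∧ p.1 ≠ p.2}

lemma card_nontrivialPairs {H : Type*} [Group H]
    (h : Nonempty (H ≃* Multiplicative (ZMod 2 × ZMod 2))) :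
    Nat.card (NontrivialPairs H) = 6 := by
  obtain ⟨e⟩ := h
  have e' : NontrivialPairs H ≃ NontrivialPairs (Multiplicative (ZMod 2 × ZMod 2)) :=
    (e.toEquiv.prodCongr e.toEquiv).subtypeEquiv fun p ↦ by simp
  rw [Nat.card_congr e', Nat.card_eq_fintype_card]
  decide

lemma IsKleinFour.of_nonempty_mulEquiv {H : Type*} [Group H]
    (h : Nonempty (H ≃* Multiplicative (ZMod 2 × ZMod 2))) : IsKleinFour H := by
  obtain ⟨e⟩ := h
  exact ⟨(Nat.card_congr e.toEquiv).trans IsKleinFour.card_four,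
    (Monoid.exponent_eq_of_mulEquiv e).trans IsKleinFour.exponent_two⟩

/-- The subgroup `{1, a, b, a * b}` generated by two commuting involutions. -/
def involutionPairSubgroup {G : Type*} [Group G] (a b : G) (ha : a * a = 1) (hb : b * b = 1)
    (hab : a * b = b * a) : Subgroup G where
  carrier := {1, a, b, a * b}
  one_mem' := by simp
  mul_mem' := by
    have h₁ : a * (a * b) = b := by rw [← mul_assoc, ha, one_mul]
    have h₂ : b * (a * b) = a := by rw [hab, ← mul_assoc, hb, one_mul]
    have h₃ : a * b * a = b := by rw [hab, mul_assoc, ha, mul_one]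
    have h₄ : a * b * b = a := by rw [mul_assoc, hb, mul_one]
    have h₅ : a * b * (a * b) = 1 := by rw [← mul_assoc, h₃, hb]
    intro u v hu hv
    simp only [Set.mem_insert_iff, Set.mem_singleton_iff] at hu hv ⊢
    rcases hu with hu | hu | hu | hu <;> rcases hv with hv | hv | hv | hv <;>
      simp only [hu, hv, ha, hb, h₁, h₂, h₃, h₄, h₅, ← hab, one_mul, mul_one, true_or, or_true]
  inv_mem' := by
    have h₁ : a⁻¹ = a := inv_eq_of_mul_eq_one_right ha
    have h₂ : b⁻¹ = b := inv_eq_of_mul_eq_one_right hb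
    intro u hu
    simp only [Set.mem_insert_iff, Set.mem_singleton_iff] at hu ⊢
    rcases hu with hu | hu | hu | hu <;> simp [hu, h₁, h₂, ← hab]

lemma mem_involutionPairSubgroup {G : Type*} [Group G] {a b : G} {ha : a * a = 1}
    {hb : b * b = 1} {hab : a * b = b * a} {u : G} :
    u ∈ involutionPairSubgroup a b ha hb hab ↔ u = 1 ∨ u = a ∨ u = b ∨ u = a * b :=
  Iff.rfl

lemma nonempty_mulEquiv_involutionPairSubgroup {G : Type*} [Group G] {a b : G} (ha : a * a = 1)
    (hb : b * b = 1) (hab : a * b = b * a) (ha₁ : a ≠ 1) (hb₁ : b ≠ 1) (hne : a ≠ b) :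
    Nonempty (involutionPairSubgroup a b ha hb hab ≃* Multiplicative (ZMod 2 × ZMod 2)) := by
  classical
  have hab₁ : a * b ≠ 1 := fun h ↦ hne (by rw [← mul_one a, ← hb, ← mul_assoc, h, one_mul])
  have hcard : Nat.card (involutionPairSubgroup a b ha hb hab) = 4 := by
    have h : ((involutionPairSubgroup a b ha hb hab : Subgroup G) : Set G) =
        (({1, a, b, a * b} : Finset G) : Set G) := by
      ext
      simp [mem_involutionPairSubgroup]
    rw [← SetLike.coe_sort_coe, Nat.card_coe_set_eq, h, Set.ncard_coe_finset]
    simp [Finset.card_insert_of_notMem, ha₁.symm, hb₁.symm, hab₁.symm, hne, ha₁, hb₁]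
  have : Finite (involutionPairSubgroup a b ha hb hab) :=
    Nat.finite_of_card_ne_zero (by simp [hcard])
  have : Nontrivial (involutionPairSubgroup a b ha hb hab) :=
    Finite.one_lt_card_iff_nontrivial.1 (by simp [hcard])
  have : IsKleinFour (involutionPairSubgroup a b ha hb hab) := by
    refine ⟨hcard, (Monoid.exponent_eq_prime_iff Nat.prime_two).2 ?_⟩
    rintro ⟨u, hu⟩ hu₁
    refine orderOf_eq_prime ?_ hu₁
    rw [Subtype.ext_iff]
    simp only [sq, Subgroup.coe_mul, Subgroup.coe_one]
    rcases mem_involutionPairSubgroup.1 hu with rfl | rfl | rfl | rfl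
    · simp
    · exact ha
    · exact hb
    · rw [mul_assoc, hab, ← mul_assoc b, hb, one_mul, ha]
  exact IsKleinFour.nonempty_mulEquiv

lemma Subgroup.eq_involutionPairSubgroup {G : Type*} [Group G] {H : Subgroup G}
    (hH : Nonempty (H ≃* Multiplicative (ZMod 2 × ZMod 2))) (p : NontrivialPairs H)
    (ha : (p.1.1 : G) * p.1.1 = 1) (hb : (p.1.2 : G) * p.1.2 = 1)
    (hab : (p.1.1 : G) * p.1.2 = p.1.2 * p.1.1) :
    H = involutionPairSubgroup (p.1.1 : G) p.1.2 ha hb hab := by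
  classical
  have := IsKleinFour.of_nonempty_mulEquiv hH
  have : Finite H := IsKleinFour.instFinite
  have := Fintype.ofFinite H
  have huniv := IsKleinFour.eq_finset_univ p.2.1 p.2.2.1 p.2.2.2
  ext u
  constructor
  · intro hu
    have hmem := Finset.mem_univ (⟨u, hu⟩ : H)
    rw [← huniv] at hmem
    simp only [Finset.mem_insert, Finset.mem_singleton, Subtype.ext_iff, Subgroup.coe_mul,
      Subgroup.coe_one] at hmem
    rw [mem_involutionPairSubgroup]
    tauto
  · rw [mem_involutionPairSubgroup]
    rintro (rfl | rfl | rfl | rfl)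
    exacts [H.one_mem, p.1.1.2, p.1.2.2, H.mul_mem p.1.1.2 p.1.2.2]

lemma card_commutingInvolutionPairs (G : Type*) [Group G] [Finite G] :
    Nat.card (commutingInvolutionPairs G) = Nat.card {H : Subgroup G //
        Nonempty (H ≃* Multiplicative (ZMod 2 × ZMod 2))} * 6 := by
  have hK (H : {H : Subgroup G // Nonempty (H ≃* Multiplicative (ZMod 2 × ZMod 2))}) :
      IsKleinFour H.1 := .of_nonempty_mulEquiv H.2
  have hsq (H : {H : Subgroup G // Nonempty (H ≃* Multiplicative (ZMod 2 × ZMod 2))})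
      (u : H.1) : (u : G) * u = 1 := by
    have := hK H
    exact congrArg Subtype.val (IsKleinFour.mul_self u)
  have hcomm (H : {H : Subgroup G // Nonempty (H ≃* Multiplicative (ZMod 2 × ZMod 2))})
      (u v : H.1) : (u : G) * v = v * u := by
    have := hK H
    exact congrArg Subtype.val (IsKleinFour.isMulCommutative.is_comm.comm u v)
  let f : (Σ H : {H : Subgroup G // Nonempty (H ≃* Multiplicative (ZMod 2 × ZMod 2))},
      NontrivialPairs H.1) → commutingInvolutionPairs G := fun x ↦
    ⟨(x.2.1.1, x.2.1.2), fun h ↦ x.2.2.1 (Subtype.ext h), fun h ↦ x.2.2.2.1 (Subtype.ext h),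
      fun h ↦ x.2.2.2.2 (Subtype.ext h), hsq _ _, hsq _ _, hcomm _ _ _⟩
  have hf : Function.Bijective f := by
    constructor
    · rintro ⟨⟨H, hH⟩, p⟩ ⟨⟨K, hK⟩, r⟩ h
      have h₁ : (p.1.1 : G) = r.1.1 := congrArg (fun z ↦ z.1.1) h
      have h₂ : (p.1.2 : G) = r.1.2 := congrArg (fun z ↦ z.1.2) h
      have hHK : H = K := by
        rw [Subgroup.eq_involutionPairSubgroup hH p (hsq ⟨H, hH⟩ _) (hsq ⟨H, hH⟩ _)
            (hcomm ⟨H, hH⟩ _ _),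
          Subgroup.eq_involutionPairSubgroup hK r (hsq ⟨K, hK⟩ _) (hsq ⟨K, hK⟩ _)
            (hcomm ⟨K, hK⟩ _ _)]
        simp only [h₁, h₂]
      subst hHK
      congr 1
      exact Subtype.ext (Prod.ext (Subtype.ext h₁) (Subtype.ext h₂))
    · rintro ⟨⟨a, b⟩, ha₁, hb₁, hne, ha, hb, hab⟩
      exact ⟨⟨⟨_, nonempty_mulEquiv_involutionPairSubgroup ha hb hab ha₁ hb₁ hne⟩,
        ⟨(⟨a, by simp [mem_involutionPairSubgroup]⟩, ⟨b, by simp [mem_involutionPairSubgroup]⟩),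
          fun h ↦ ha₁ (congrArg Subtype.val h), fun h ↦ hb₁ (congrArg Subtype.val h),
          fun h ↦ hne (congrArg Subtype.val h)⟩⟩, rfl⟩
  have := Fintype.ofFinite {H : Subgroup G // Nonempty (H ≃* Multiplicative (ZMod 2 × ZMod 2))}
  rw [← Nat.card_eq_of_bijective f hf, Nat.card_sigma,
    Finset.sum_congr rfl fun H _ ↦ card_nontrivialPairs H.2]
  simp [Nat.card_eq_fintype_card]

lemma MonoidHom.card_preimage_of_surjective {G H : Type*} [Group G] [Group H] (f : G →* H)
    (hf : Function.Surjective f) (T : Set H) :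
    Nat.card (f ⁻¹' T) = Nat.card T * Nat.card f.ker := by
  rw [← Nat.card_prod]
  refine (Nat.card_eq_of_bijective (fun x : T × f.ker ↦
    (⟨Function.surjInv hf x.1 * x.2, ?_⟩ : f ⁻¹' T)) ⟨?_, ?_⟩).symm
  · have h := f.mem_ker.1 x.2.2
    rw [Set.mem_preimage, map_mul, h, mul_one, Function.surjInv_eq hf]
    exact x.1.2
  · rintro ⟨t, k⟩ ⟨t', k'⟩ h
    have h' := congrArg Subtype.val h
    have ht : t = t' := by
      have hfh := congrArg f h'
      simp only [map_mul, f.mem_ker.1 k.2, f.mem_ker.1 k'.2, Function.surjInv_eq hf,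
        mul_one] at hfh
      exact Subtype.ext hfh
    subst ht
    exact Prod.ext rfl (Subtype.ext (mul_left_cancel h'))
  · rintro ⟨g, hg⟩
    refine ⟨(⟨f g, hg⟩, ⟨(Function.surjInv hf (f g))⁻¹ * g, ?_⟩), ?_⟩
    · simp [f.mem_ker, Function.surjInv_eq hf]
    · simp

section frames

variable {F R : Type*} [Field F] [Ring R] [Algebra F R]

/-- Pairs of anticommuting square roots of `-1`. -/
def quaternionPairs (R : Type*) [Ring R] : Set (R × R) :=
  {p | p.1 * p.1 = -1 ∧ p.2 * p.2 = -1 ∧ p.1 * p.2 = -(p.2 * p.1)}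

/-- Pairs consisting of a square root of `1` and a square root of `-1` that anticommute. -/
def splitQuaternionPairs (R : Type*) [Ring R] : Set (R × R) :=
  {p | p.1 * p.1 = 1 ∧ p.2 * p.2 = -1 ∧ p.1 * p.2 = -(p.2 * p.1)}

/-- Pairs of square-zero elements whose anticommutator is `1`. -/
def hyperbolicPairs (R : Type*) [Ring R] : Set (R × R) :=
  {p | p.1 * p.1 = 0 ∧ p.2 * p.2 = 0 ∧ p.1 * p.2 + p.2 * p.1 = 1}

/-- A solution of `x ^ 2 + y ^ 2 = -1` turns quaternion pairs into split quaternion pairs. -/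
def quaternionPairsEquiv (R : Type*) [Ring R] [Algebra F R] {x y : F} (h : x * x + y * y = -1) :
    quaternionPairs R ≃ splitQuaternionPairs R where
  toFun p := ⟨(x • p.1.1 + y • p.1.2, p.1.1 * p.1.2), by
    obtain ⟨⟨A, B⟩, hA, hB, hAB⟩ := p
    dsimp only at hA hB hAB ⊢
    have h₁ : A * (A * B) = -B := by rw [← mul_assoc, hA, neg_one_mul]
    have h₂ : B * (A * B) = A := by rw [hAB, mul_neg, ← mul_assoc, hB, neg_one_mul, neg_neg]
    have h₃ : A * B * A = B := by rw [hAB, neg_mul, mul_assoc, hA, mul_neg_one, neg_neg]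
    have h₄ : A * B * B = -A := by rw [mul_assoc, hB, mul_neg_one]
    have h₅ : B * A = -(A * B) := by rw [hAB, neg_neg]
    refine ⟨?_, ?_, ?_⟩
    · simp only [mul_add, add_mul, smul_mul_smul_comm, hA, hB, h₅]
      linear_combination (norm := module) -h • (1 : R)
    · simp only [← mul_assoc, h₃, hB]
    · simp only [mul_add, add_mul, smul_mul_assoc, mul_smul_comm, h₁, h₂, h₃, h₄]
      module⟩
  invFun p := ⟨(y • (p.1.2 * p.1.1) - x • p.1.1, -(y • p.1.1 + x • (p.1.2 * p.1.1))), by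
    obtain ⟨⟨C, D⟩, hC, hD, hCD⟩ := p
    dsimp only at hC hD hCD ⊢
    have h₁ : C * (D * C) = -D := by rw [← mul_assoc, hCD, neg_mul, mul_assoc, hC, mul_one]
    have h₂ : D * C * C = D := by rw [mul_assoc, hC, mul_one]
    have h₃ : D * C * (D * C) = 1 := by
      rw [mul_assoc, h₁, mul_neg, hD, neg_neg]
    refine ⟨?_, ?_, ?_⟩
    · simp only [mul_sub, sub_mul, smul_mul_smul_comm, hC, h₁, h₂, h₃]
      linear_combination (norm := module) h • (1 : R)
    · simp only [neg_mul_neg, mul_add, add_mul, smul_mul_smul_comm, hC, h₁, h₂, h₃]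
      linear_combination (norm := module) h • (1 : R)
    · simp only [mul_neg, neg_mul, mul_sub, sub_mul, mul_add, add_mul, smul_mul_smul_comm, hC,
        h₁, h₂, h₃]
      module⟩
  left_inv p := by
    obtain ⟨⟨A, B⟩, hA, hB, hAB⟩ := p
    dsimp only at hA hB hAB
    have h₃ : A * B * A = B := by rw [hAB, neg_mul, mul_assoc, hA, mul_neg_one, neg_neg]
    have h₄ : A * B * B = -A := by rw [mul_assoc, hB, mul_neg_one]
    ext1
    ext1
    · simp only [mul_add, mul_smul_comm, h₃, h₄]
      linear_combination (norm := module) -h • A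
    · simp only [mul_add, mul_smul_comm, h₃, h₄]
      linear_combination (norm := module) -h • B
  right_inv p := by
    obtain ⟨⟨C, D⟩, hC, hD, hCD⟩ := p
    dsimp only at hC hD hCD
    have h₁ : C * (D * C) = -D := by rw [← mul_assoc, hCD, neg_mul, mul_assoc, hC, mul_one]
    have h₂ : D * C * C = D := by rw [mul_assoc, hC, mul_one]
    have h₃ : D * C * (D * C) = 1 := by
      rw [mul_assoc, h₁, mul_neg, hD, neg_neg]
    ext1
    ext1
    · dsimp only
      linear_combination (norm := module) -h • C
    · simp only [mul_neg, sub_mul, mul_add, smul_mul_smul_comm, hC, h₁, h₂, h₃]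
      linear_combination (norm := module) -h • D

/-- Away from characteristic two, `(N, M) ↦ (N + M, N - M)` turns hyperbolic pairs into split
quaternion pairs. -/
def hyperbolicPairsEquiv (F R : Type*) [Field F] [Ring R] [Algebra F R] (h2 : (2 : F) ≠ 0) :
    hyperbolicPairs R ≃ splitQuaternionPairs R where
  toFun p := ⟨(p.1.1 + p.1.2, p.1.1 - p.1.2), by
    obtain ⟨⟨N, M⟩, hN, hM, hNM⟩ := p
    dsimp only at hN hM hNM ⊢
    refine ⟨?_, ?_, ?_⟩
    · simp only [mul_add, add_mul, hN, hM]
      linear_combination (norm := abel) hNM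
    · simp only [mul_sub, sub_mul, hN, hM]
      linear_combination (norm := abel) -hNM
    · simp only [mul_sub, sub_mul, mul_add, add_mul, hN, hM]
      abel⟩
  invFun p := ⟨((2⁻¹ : F) • (p.1.1 + p.1.2), (2⁻¹ : F) • (p.1.1 - p.1.2)), by
    obtain ⟨⟨C, D⟩, hC, hD, hCD⟩ := p
    dsimp only at hC hD hCD ⊢
    refine ⟨?_, ?_, ?_⟩
    · simp only [mul_add, add_mul, smul_mul_smul_comm, hC, hD, hCD]
      module
    · simp only [mul_sub, sub_mul, smul_mul_smul_comm, hC, hD, hCD]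
      module
    · simp only [mul_sub, sub_mul, mul_add, add_mul, smul_mul_smul_comm, hC, hD, hCD]
      match_scalars <;> field_simp <;> ring⟩
  left_inv p := by
    ext1
    ext1 <;> dsimp only <;> match_scalars <;> field_simp <;> ring
  right_inv p := by
    ext1
    ext1 <;> dsimp only <;> match_scalars <;> field_simp <;> ring

end frames

lemma Matrix.mul_self_eq_zero_iff_fin_two {F : Type*} [Field F] (N : Matrix (Fin 2) (Fin 2) F) :
    N * N = 0 ↔ N 1 1 = -N 0 0 ∧ N 0 0 * N 0 0 + N 0 1 * N 1 0 = 0 := by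
  rw [← Matrix.ext_iff]
  simp only [Fin.forall_fin_two, Matrix.mul_apply, Fin.sum_univ_two, Matrix.zero_apply]
  constructor
  · rintro ⟨⟨h₁, h₂⟩, h₃, h₄⟩
    refine ⟨?_, h₁⟩
    by_contra h
    have ht : N 0 0 + N 1 1 ≠ 0 := fun h' ↦ h (by linear_combination h')
    have hb : N 0 1 = 0 := (mul_eq_zero.1 (by linear_combination h₂)).resolve_left ht
    have ha : N 0 0 = 0 := by simpa [hb] using h₁
    have hd : N 1 1 = 0 := by simpa [hb] using h₄
    simp [ha, hd] at h
  · rintro ⟨h, h'⟩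
    rw [h]
    exact ⟨⟨h', by ring⟩, by ring, by linear_combination h'⟩

/-- The hyperbolic pairs `(N, M)` of matrices with `N 0 1 ≠ 0`, parametrized by `N 0 1`, `N 0 0`
and `N 0 1 * M 0 0 - N 0 0 * M 0 1`. -/
def hyperbolicPairOfNeZero {F : Type*} [Field F] (z : Fˣ × F × F) :
    hyperbolicPairs (Matrix (Fin 2) (Fin 2) F) :=
  ⟨(!![z.2.1, z.1; -z.2.1 ^ 2 / z.1, -z.2.1],
    !![z.2.2 / z.1 - z.2.1 * z.2.2 ^ 2 / z.1 ^ 2, -z.2.2 ^ 2 / z.1;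
      (1 - z.2.1 * z.2.2 / z.1) ^ 2 / z.1, -(z.2.2 / z.1 - z.2.1 * z.2.2 ^ 2 / z.1 ^ 2)]), by
    obtain ⟨p, n, u⟩ := z
    have hp : (p : F) ≠ 0 := p.ne_zero
    refine ⟨?_, ?_, ?_⟩
    · rw [Matrix.mul_self_eq_zero_iff_fin_two]
      simp
      field_simp
      ring
    · rw [Matrix.mul_self_eq_zero_iff_fin_two]
      simp
      field_simp
      ring
    · ext i j
      fin_cases i <;> fin_cases j <;> simp <;> field_simp <;> ring⟩

/-- The hyperbolic pairs `(N, M)` of matrices with `N 0 1 = 0`, parametrized by `N 1 0` and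
`M 0 0`. -/
def hyperbolicPairOfEqZero {F : Type*} [Field F] (z : Fˣ × F) :
    hyperbolicPairs (Matrix (Fin 2) (Fin 2) F) :=
  ⟨(!![0, 0; z.1, 0], !![z.2, (z.1 : F)⁻¹; -(z.1 * z.2 ^ 2), -z.2]), by
    obtain ⟨r, m⟩ := z
    have hr : (r : F) ≠ 0 := r.ne_zero
    refine ⟨?_, ?_, ?_⟩
    · rw [Matrix.mul_self_eq_zero_iff_fin_two]
      simp
    · rw [Matrix.mul_self_eq_zero_iff_fin_two]
      simp
      field_simp
      ring
    · ext i j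
      fin_cases i <;> fin_cases j <;> simp
      ring⟩

lemma hyperbolicPairOfNeZero_injective {F : Type*} [Field F] :
    Function.Injective (hyperbolicPairOfNeZero (F := F)) := by
  rintro ⟨p, n, u⟩ ⟨p', n', u'⟩ h
  have h₁ : (p : F) = p' := congrArg (fun X ↦ X.1.1 0 1) h
  have h₂ : n = n' := congrArg (fun X ↦ X.1.1 0 0) h
  have h₃ : -u ^ 2 / p = -u' ^ 2 / p' := congrArg (fun X ↦ X.1.2 0 1) h
  have h₄ : u / p - n * u ^ 2 / p ^ 2 = u' / p' - n' * u' ^ 2 / p' ^ 2 :=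
    congrArg (fun X ↦ X.1.2 0 0) h
  have hp : (p' : F) ≠ 0 := p'.ne_zero
  obtain rfl := Units.ext h₁
  subst h₂
  have h₅ : u = u' := by
    field_simp at h₃ h₄
    exact mul_left_cancel₀ hp (by linear_combination h₄ - n * h₃)
  rw [h₅]

lemma hyperbolicPairOfEqZero_injective {F : Type*} [Field F] :
    Function.Injective (hyperbolicPairOfEqZero (F := F)) := by
  rintro ⟨r, m⟩ ⟨r', m'⟩ h
  have h₁ : (r : F) = r' := congrArg (fun X ↦ X.1.1 1 0) h
  have h₂ : m = m' := congrArg (fun X ↦ X.1.2 0 0) h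
  rw [Units.ext h₁, h₂]

lemma hyperbolicPairOfNeZero_ne_hyperbolicPairOfEqZero {F : Type*} [Field F] (z : Fˣ × F × F)
    (w : Fˣ × F) : hyperbolicPairOfNeZero z ≠ hyperbolicPairOfEqZero w := fun h ↦
  z.1.ne_zero (congrArg (fun X ↦ X.1.1 0 1) h)

lemma exists_hyperbolicPairOf_eq {F : Type*} [Field F]
    (X : hyperbolicPairs (Matrix (Fin 2) (Fin 2) F)) :
    (∃ z, hyperbolicPairOfNeZero z = X) ∨ ∃ w, hyperbolicPairOfEqZero w = X := by
  obtain ⟨⟨N, M⟩, hN, hM, hNM⟩ := X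
  obtain ⟨n, p, r, n', rfl⟩ : ∃ n p r n', N = !![n, p; r, n'] :=
    ⟨_, _, _, _, Matrix.eta_fin_two N⟩
  obtain ⟨m, s, t, m', rfl⟩ : ∃ m s t m', M = !![m, s; t, m'] :=
    ⟨_, _, _, _, Matrix.eta_fin_two M⟩
  obtain ⟨hN₁, hN₂⟩ := (Matrix.mul_self_eq_zero_iff_fin_two _).1 hN
  obtain ⟨hM₁, hM₂⟩ := (Matrix.mul_self_eq_zero_iff_fin_two _).1 hM
  have h₀ : n * m + p * t + (m * n + s * r) = 1 := by
    simpa [Matrix.mul_apply, Fin.sum_univ_two] using congrArg (fun X ↦ X 0 0) hNM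
  change n' = -n at hN₁
  change m' = -m at hM₁
  change n * n + p * r = 0 at hN₂
  change m * m + s * t = 0 at hM₂
  subst hN₁ hM₁
  by_cases hp : p = 0
  · right
    have hn : n = 0 := by simpa [hp] using hN₂
    subst hp hn
    have hr : r ≠ 0 := by
      rintro rfl
      simp at h₀
    have hs : s = r⁻¹ := by
      field_simp
      linear_combination h₀
    have ht : t = -(r * m ^ 2) := by
      linear_combination r * hM₂ - t * h₀
    subst hs ht
    exact ⟨(.mk0 r hr, m), by simp [hyperbolicPairOfEqZero]⟩
  · left
    have hr : r = -n ^ 2 / p := by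
      field_simp
      linear_combination hN₂
    have ht : t = (1 - 2 * n * m - r * s) / p := by
      field_simp
      linear_combination h₀
    subst hr ht
    have hs : (p * m - n * s) ^ 2 = -p * s := by
      field_simp at hM₂
      linear_combination hM₂
    have hs' : s = -(p * m - n * s) ^ 2 / p := by
      rw [hs]
      field_simp
    have hm : m = (p * m - n * s) / p - n * (p * m - n * s) ^ 2 / p ^ 2 := by
      rw [hs]
      field_simp
      ring
    have ht : (1 - n * (p * m - n * s) / p) ^ 2 / p =
        (1 - 2 * n * m - -n ^ 2 / p * s) / p := by
      field_simp
      linear_combination n ^ 2 * hs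
    refine ⟨(.mk0 p hp, n, p * m - n * s), ?_⟩
    simp only [hyperbolicPairOfNeZero, Units.val_mk0, ← hs', ← hm, ht]

lemma card_hyperbolicPairs_matrix_fin_two (F : Type*) [Field F] [Fintype F] :
    Nat.card (hyperbolicPairs (Matrix (Fin 2) (Fin 2) F)) =
      Fintype.card F * (Fintype.card F ^ 2 - 1) := by
  have hf : Function.Bijective
      (Sum.elim (hyperbolicPairOfNeZero (F := F)) hyperbolicPairOfEqZero) :=
    ⟨hyperbolicPairOfNeZero_injective.sumElim hyperbolicPairOfEqZero_injective
      hyperbolicPairOfNeZero_ne_hyperbolicPairOfEqZero, fun X ↦ by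
        simpa using exists_hyperbolicPairOf_eq X⟩
  rw [← Nat.card_eq_of_bijective _ hf, Nat.card_sum, Nat.card_prod, Nat.card_prod, Nat.card_prod,
    Nat.card_units, Nat.card_eq_fintype_card]
  obtain ⟨k, hk⟩ := Nat.exists_eq_add_of_lt (Fintype.card_pos (α := F))
  rw [hk, zero_add, Nat.add_sub_cancel, show (k + 1) ^ 2 - 1 = k * (k + 2) by
    rw [Nat.sub_eq_iff_eq_add (Nat.one_le_pow 2 (k + 1) k.succ_pos)]; ring]
  ring

open Matrix in
lemma Matrix.SpecialLinearGroup.eq_one_or_eq_neg_one_of_mul_self {F : Type*} [Field F]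
    (h2 : (2 : F) ≠ 0) {A : SpecialLinearGroup (Fin 2) F} (hA : A * A = 1) : A = 1 ∨ A = -1 := by
  have hinv : A = A⁻¹ := eq_inv_of_mul_eq_one_left hA
  have h (i j) : A i j = A⁻¹ i j := by rw [← hinv]
  have h₀₀ : A 0 0 = A 1 1 := by simpa [SpecialLinearGroup.coe_inv, adjugate_fin_two] using h 0 0
  have h₀₁ : A 0 1 = -A 0 1 := by simpa [SpecialLinearGroup.coe_inv, adjugate_fin_two] using h 0 1
  have h₁₀ : A 1 0 = -A 1 0 := by simpa [SpecialLinearGroup.coe_inv, adjugate_fin_two] using h 1 0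
  have hb : A 0 1 = 0 := (mul_eq_zero.1 (by linear_combination h₀₁)).resolve_left h2
  have hc : A 1 0 = 0 := (mul_eq_zero.1 (by linear_combination h₁₀)).resolve_left h2
  have hdet : A 0 0 * A 0 0 = 1 := by
    have h' := A.det_coe
    rw [det_fin_two, hb, ← h₀₀] at h'
    linear_combination h'
  refine (mul_self_eq_one_iff.1 hdet).imp (fun ha ↦ ?_) (fun ha ↦ ?_) <;> ext i j <;>
    fin_cases i <;> fin_cases j <;> simp [hb, hc, ha, ← h₀₀]

/-- The projection from `SL₂(F)` onto `PSL₂(F)`. -/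
def toPSL2 (F : Type*) [Field F] : Matrix.SpecialLinearGroup (Fin 2) F →* PSL2 F :=
  ((QuotientGroup.mk' (Subgroup.center (Matrix.GeneralLinearGroup (Fin 2) F))).comp
    Matrix.SpecialLinearGroup.toGL).rangeRestrict

lemma toPSL2_surjective (F : Type*) [Field F] : Function.Surjective (toPSL2 F) :=
  MonoidHom.rangeRestrict_surjective _

open Matrix in
lemma toPSL2_eq_one_iff {F : Type*} [Field F] (A : SpecialLinearGroup (Fin 2) F) :
    toPSL2 F A = 1 ↔ A = 1 ∨ A = -1 := by
  have h : toPSL2 F A = 1 ↔ SpecialLinearGroup.toGL A ∈ Subgroup.center (GL (Fin 2) F) := by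
    rw [← QuotientGroup.eq_one_iff, Subtype.ext_iff]
    rfl
  rw [h]
  constructor
  · intro hA
    have hA' : A ∈ Subgroup.center (SpecialLinearGroup (Fin 2) F) := by
      rw [Subgroup.mem_center_iff] at hA ⊢
      intro B
      apply SpecialLinearGroup.toGL_injective
      rw [map_mul, map_mul, hA]
    obtain ⟨r, hr, hrA⟩ := Matrix.SpecialLinearGroup.mem_center_iff.1 hA'
    refine (mul_self_eq_one_iff.1 (by simpa [sq] using hr)).imp (fun h ↦ ?_) (fun h ↦ ?_) <;>
      exact Subtype.ext (by rw [← hrA, h]; simp only [map_neg, map_one]; rfl)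
  · rw [Subgroup.mem_center_iff]
    rintro (rfl | rfl) g <;> ext i j <;> simp

lemma toPSL2_eq_iff {F : Type*} [Field F] (A B : Matrix.SpecialLinearGroup (Fin 2) F) :
    toPSL2 F A = toPSL2 F B ↔ A = B ∨ A = -B := by
  rw [← mul_inv_eq_one, ← map_inv, ← map_mul, toPSL2_eq_one_iff, mul_inv_eq_one,
    mul_inv_eq_iff_eq_mul, neg_one_mul]

lemma Matrix.SpecialLinearGroup.neg_one_ne_one {F : Type*} [Field F] (h2 : (2 : F) ≠ 0) :
    (-1 : Matrix.SpecialLinearGroup (Fin 2) F) ≠ 1 := fun h ↦ by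
  have h' : (-1 : F) = 1 := by simpa using congrArg (fun X ↦ X 0 0) h
  exact h2 (by linear_combination -h')

lemma card_ker_toPSL2 {F : Type*} [Field F] (h2 : (2 : F) ≠ 0) :
    Nat.card (toPSL2 F).ker = 2 := by
  have h : ((toPSL2 F).ker : Set (Matrix.SpecialLinearGroup (Fin 2) F)) = {1, -1} := by
    ext A
    simp [MonoidHom.mem_ker, toPSL2_eq_one_iff]
  rw [← SetLike.coe_sort_coe, Nat.card_coe_set_eq, h,
    Set.ncard_pair (Matrix.SpecialLinearGroup.neg_one_ne_one h2).symm]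

lemma mem_commutingInvolutionPairs_toPSL2_iff {F : Type*} [Field F] (h2 : (2 : F) ≠ 0)
    (A B : Matrix.SpecialLinearGroup (Fin 2) F) :
    (toPSL2 F A, toPSL2 F B) ∈ commutingInvolutionPairs (PSL2 F) ↔
      A * A = -1 ∧ B * B = -1 ∧ A * B = -(B * A) := by
  have hne := Matrix.SpecialLinearGroup.neg_one_ne_one h2
  have hsq {C : Matrix.SpecialLinearGroup (Fin 2) F} (hC : C * C = -1) : ¬(C = 1 ∨ C = -1) := by
    rintro (rfl | rfl) <;> simp [hne.symm] at hC
  simp only [commutingInvolutionPairs, Set.mem_ofPred_eq, ← map_mul, ne_eq, toPSL2_eq_one_iff,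
    toPSL2_eq_iff]
  constructor
  · rintro ⟨hA, hB, hAB, hA', hB', hcomm⟩
    replace hA' := hA'.resolve_left fun h ↦
      hA (Matrix.SpecialLinearGroup.eq_one_or_eq_neg_one_of_mul_self h2 h)
    replace hB' := hB'.resolve_left fun h ↦
      hB (Matrix.SpecialLinearGroup.eq_one_or_eq_neg_one_of_mul_self h2 h)
    refine ⟨hA', hB', hcomm.resolve_left fun h ↦ hAB ?_⟩
    have hsqAB : A * B * (A * B) = 1 := by
      calc A * B * (A * B) = A * B * (B * A) := by rw [h]
        _ = 1 := by
          rw [mul_assoc, ← mul_assoc B, hB', neg_one_mul, mul_neg, hA', neg_neg]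
    have hAinv : A * B * B = -A := by rw [mul_assoc, hB', mul_neg, mul_one]
    rcases Matrix.SpecialLinearGroup.eq_one_or_eq_neg_one_of_mul_self h2 hsqAB with h' | h' <;>
      rw [h'] at hAinv
    · right
      rw [← neg_neg A, ← hAinv, one_mul]
    · left
      rw [← neg_neg A, ← hAinv, neg_one_mul, neg_neg]
  · rintro ⟨hA, hB, hcomm⟩
    refine ⟨hsq hA, hsq hB, ?_, .inr hA, .inr hB, .inr hcomm⟩
    rintro (rfl | rfl) <;> simp [hA, hB, hne, hne.symm] at hcomm

lemma Matrix.det_eq_one_of_mem_quaternionPairs {F : Type*} [Field F] (h2 : (2 : F) ≠ 0)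
    {A B : Matrix (Fin 2) (Fin 2) F} (h : (A, B) ∈ quaternionPairs (Matrix (Fin 2) (Fin 2) F)) :
    A.det = 1 := by
  obtain ⟨hA, hB, hAB⟩ := h
  dsimp only at hA hB hAB
  have htr : A.trace = 0 := by
    have h : B * A * B = A := by
      rw [← neg_neg (B * A), ← hAB, neg_mul, mul_assoc, hB, mul_neg_one, neg_neg]
    have h' : A.trace = -A.trace := by
      conv_lhs => rw [← h, Matrix.trace_mul_comm, ← mul_assoc, hB, neg_one_mul, Matrix.trace_neg]
    exact (mul_eq_zero.1 (by linear_combination h')).resolve_left h2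
  have h₀₀ := congrArg (fun X ↦ X 0 0) hA
  simp [Matrix.mul_apply, Fin.sum_univ_two] at h₀₀
  rw [Matrix.trace_fin_two] at htr
  rw [Matrix.det_fin_two]
  linear_combination A 0 0 * htr - h₀₀

lemma swap_mem_quaternionPairs {R : Type*} [Ring R] {A B : R} (h : (A, B) ∈ quaternionPairs R) :
    (B, A) ∈ quaternionPairs R :=
  ⟨h.2.1, h.1, by rw [h.2.2, neg_neg]⟩

lemma card_quaternionPairs_eq {F : Type*} [Field F] (h2 : (2 : F) ≠ 0) :
    Nat.card (quaternionPairs (Matrix (Fin 2) (Fin 2) F)) =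
      Nat.card (commutingInvolutionPairs (PSL2 F)) * 4 := by
  let π := (toPSL2 F).prodMap (toPSL2 F)
  have hπ : Function.Surjective π := (toPSL2_surjective F).prodMap (toPSL2_surjective F)
  have hker : Nat.card π.ker = 4 := by
    rw [MonoidHom.ker_prodMap, Nat.card_congr (Subgroup.prodEquiv _ _).toEquiv, Nat.card_prod,
      card_ker_toPSL2 h2]
  rw [← hker, ← MonoidHom.card_preimage_of_surjective π hπ]
  have hcoe (p : π ⁻¹' commutingInvolutionPairs (PSL2 F)) :
      ((p.1.1 : Matrix (Fin 2) (Fin 2) F), (p.1.2 : Matrix (Fin 2) (Fin 2) F)) ∈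
        quaternionPairs (Matrix (Fin 2) (Fin 2) F) := by
    obtain ⟨hA, hB, hAB⟩ := (mem_commutingInvolutionPairs_toPSL2_iff h2 _ _).1 p.2
    exact ⟨by simpa using congrArg Subtype.val hA, by simpa using congrArg Subtype.val hB,
      by simpa using congrArg Subtype.val hAB⟩
  refine (Nat.card_eq_of_bijective (fun p ↦ ⟨_, hcoe p⟩) ⟨fun p p' h ↦ ?_, ?_⟩).symm
  · have h' := congrArg Subtype.val h
    exact Subtype.ext (Prod.ext (Subtype.ext (congrArg Prod.fst h'))
      (Subtype.ext (congrArg Prod.snd h')))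
  · rintro ⟨⟨A, B⟩, h⟩
    refine ⟨⟨(⟨A, Matrix.det_eq_one_of_mem_quaternionPairs h2 h⟩,
      ⟨B, Matrix.det_eq_one_of_mem_quaternionPairs h2 (swap_mem_quaternionPairs h)⟩),
      (mem_commutingInvolutionPairs_toPSL2_iff h2 _ _).2 ⟨?_, ?_, ?_⟩⟩, rfl⟩ <;>
      apply Subtype.ext
    · exact h.1.trans (by simp)
    · exact h.2.1.trans (by simp)
    · exact h.2.2.trans (by simp only [Matrix.SpecialLinearGroup.coe_neg]; rfl)

/-- For an odd prime power `q`, the number of Klein four-subgroups of `PSL₂(q)`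
is `q(q²-1)/24`. -/
theorem card_klein_four_PSL2 (q : ℕ) (hq : IsPrimePow q) (hodd : Odd q)
    (F : Type*) [Field F] [Fintype F] (hF : Fintype.card F = q) :
    24 * Nat.card {H : Subgroup (PSL2 F) //
        Nonempty (H ≃* Multiplicative (ZMod 2 × ZMod 2))} = q * (q ^ 2 - 1) := by
  have h2 : (2 : F) ≠ 0 := Ring.two_ne_zero fun h ↦ by
    have := FiniteField.even_card_of_char_two h
    rw [hF] at this
    exact Nat.not_even_iff_odd.2 hodd (Nat.even_iff.2 this)
  obtain ⟨p, hp⟩ := CharP.exists F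
  have : NeZero p := ⟨(CharP.char_is_prime F p).ne_zero⟩
  obtain ⟨x, y, hxy⟩ := CharP.sq_add_sq F p (-1)
  have hxy' : (x : F) * x + (y : F) * y = -1 := by
    simpa [sq] using hxy
  have : Finite (PSL2 F) := Subtype.finite
  have h := card_hyperbolicPairs_matrix_fin_two F
  rw [Nat.card_congr ((hyperbolicPairsEquiv F _ h2).trans (quaternionPairsEquiv _ hxy').symm),
    card_quaternionPairs_eq h2, card_commutingInvolutionPairs, hF] at h
  rw [← h]
  ring
end

section
/- Let q be an odd prime power and let ε ∈ {1,-1} be such that q ≡ ε (mod 4). Then the number of involutions of PGL_2(q) that do not lie in the subgroup PSL_2(q) is q(q-ε)/2. -/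
open Matrix

/-- Two elements of `GL₂(F)` have the same image in `PGL₂(F)` iff they are proportional. -/
theorem PGL2_mk_eq_mk_iff {F : Type*} [Field F] {g h : GL (Fin 2) F} :
    (QuotientGroup.mk g : PGL2 F) = QuotientGroup.mk h ↔ ∃ k : F, h.val = k • g.val := by
  rw [QuotientGroup.eq, GeneralLinearGroup.mem_center_iff_val_mem_range_scalar]
  constructor
  · rintro ⟨k, hk⟩
    refine ⟨k, ?_⟩
    have : h.val = g.val * (g⁻¹ * h).val := by
      rw [← Units.val_mul, mul_inv_cancel_left]
    rw [this, ← hk]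
    ext i j
    simp [scalar_apply, mul_comm]
  · rintro ⟨k, hk⟩
    refine ⟨k, ?_⟩
    rw [Units.val_mul, hk, mul_smul_comm, Units.inv_mul, smul_one_eq_diagonal, scalar_apply]

theorem PGL2_orderOf_mk_eq_two_iff {F : Type*} [Field F] (h2 : (2 : F) ≠ 0)
    (g : GL (Fin 2) F) :
    orderOf (QuotientGroup.mk g : PGL2 F) = 2 ↔ g.val 0 0 + g.val 1 1 = 0 := by
  have hdet : g.val 0 0 * g.val 1 1 - g.val 0 1 * g.val 1 0 ≠ 0 := by
    rw [← det_fin_two]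
    exact ((isUnit_iff_isUnit_det _).mp g.isUnit).ne_zero
  rw [orderOf_eq_prime_iff, ← QuotientGroup.mk_pow, ← QuotientGroup.mk_one,
    eq_comm, PGL2_mk_eq_mk_iff, ne_comm, Ne, PGL2_mk_eq_mk_iff]
  simp only [sq, Units.val_mul, Units.val_one, ← Matrix.ext_iff, Fin.forall_fin_two,
    mul_apply, Fin.sum_univ_two, Matrix.smul_apply, one_apply, smul_eq_mul, Fin.isValue,
    if_true, zero_ne_one, one_ne_zero, if_false, mul_one, mul_zero]
  generalize g.val 0 0 = a at *
  generalize g.val 0 1 = b at *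
  generalize g.val 1 0 = c at *
  generalize g.val 1 1 = d at *
  constructor
  · rintro ⟨⟨k, ⟨h00, h01⟩, h10, h11⟩, hns⟩
    by_contra hne
    have hb : b = 0 :=
      (mul_eq_zero.mp (show b * (a + d) = 0 by linear_combination h01)).resolve_right hne
    have hc : c = 0 :=
      (mul_eq_zero.mp (show c * (a + d) = 0 by linear_combination h10)).resolve_right hne
    have had : a - d = 0 :=
      (mul_eq_zero.mp (show (a - d) * (a + d) = 0 by linear_combination h00 - h11)).resolve_right hne
    exact hns ⟨a, ⟨rfl, hb⟩, hc, by linear_combination -had⟩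
  · intro h
    refine ⟨⟨a * a + b * c, ⟨rfl, ?_⟩, ?_, ?_⟩, ?_⟩
    · linear_combination b * h
    · linear_combination c * h
    · linear_combination (d - a) * h
    · rintro ⟨k, ⟨h00, h01⟩, h10, h11⟩
      have hk : k = 0 :=
        (mul_eq_zero.mp (show 2 * k = 0 by linear_combination h - h00 - h11)).resolve_left h2
      apply hdet
      rw [h00, h01, hk]
      ring

theorem mk_mem_PSL2_iff {F : Type*} [Field F] (g : GL (Fin 2) F) :
    (QuotientGroup.mk g : PGL2 F) ∈ PSL2 F ↔ IsSquare g.val.det := by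
  have hdet : g.val.det ≠ 0 := ((isUnit_iff_isUnit_det _).mp g.isUnit).ne_zero
  constructor
  · rintro ⟨s, hs⟩
    obtain ⟨k, hk⟩ := PGL2_mk_eq_mk_iff.mp hs
    refine ⟨k, ?_⟩
    rw [hk, det_smul, SpecialLinearGroup.coe_GL_coe_matrix, s.det_coe]
    simp [sq]
  · rintro ⟨k, hk⟩
    have hk0 : k ≠ 0 := by
      rintro rfl
      simp [hk] at hdet
    refine ⟨⟨k⁻¹ • g.val, ?_⟩, PGL2_mk_eq_mk_iff.mpr ⟨k, ?_⟩⟩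
    · rw [det_smul, hk, Fintype.card_fin]
      field_simp
    · change g.val = k • (k⁻¹ • g.val)
      exact (smul_inv_smul₀ hk0 _).symm

/-- The number of points of the affine quadric `a² + bc = m` over a finite field of odd
characteristic. -/
theorem card_sq_add_mul_eq {F : Type*} [Field F] [Fintype F] [DecidableEq F]
    (hF : ringChar F ≠ 2) (m : F) :
    (Fintype.card {p : F × F × F // p.2.1 ^ 2 + p.1 * p.2.2 = m} : ℤ) =
      Fintype.card F * (Fintype.card F + quadraticChar F m) := by
  have hrow (b : F) : ∑ a : F, ∑ c : F, (if a ^ 2 + b * c = m then (1 : ℤ) else 0) =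
      Fintype.card F + if b = 0 then Fintype.card F * quadraticChar F m else 0 := by
    by_cases hb : b = 0
    · have h := quadraticChar_card_sqrts hF m
      rw [Set.toFinset_ofPred, Finset.card_filter] at h
      push_cast at h
      simp only [hb, zero_mul, add_zero, Finset.sum_const, Finset.card_univ, nsmul_eq_mul,
        ← Finset.mul_sum, h, if_true]
      ring
    · have hiff (a c : F) : a ^ 2 + b * c = m ↔ c = (m - a ^ 2) / b := by
        rw [eq_div_iff hb]
        constructor <;> intro h <;> linear_combination h
      simp [hiff, hb]
  rw [Fintype.card_subtype, Finset.card_filter]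
  push_cast
  simp only [Fintype.sum_prod_type, hrow, Finset.sum_add_distrib, Finset.sum_ite_eq',
    Finset.mem_univ, if_true, Finset.sum_const, Finset.card_univ, nsmul_eq_mul]
  ring

/-- Traceless elements of `GL₂(F)` of determinant `d` correspond to points of an affine
quadric. -/
def tracelessEquiv {F : Type*} [Field F] {d : F} (hd : d ≠ 0) :
    {g : GL (Fin 2) F // g.val 0 0 + g.val 1 1 = 0 ∧ g.val.det = d} ≃
      {p : F × F × F // p.2.1 ^ 2 + p.1 * p.2.2 = -d} where
  toFun g := ⟨(g.1.val 0 1, g.1.val 0 0, g.1.val 1 0), by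
    obtain ⟨h, h'⟩ := g.2
    rw [det_fin_two] at h'
    linear_combination g.1.val 0 0 * h - h'⟩
  invFun p := ⟨GeneralLinearGroup.mkOfDetNeZero !![p.1.2.1, p.1.1; p.1.2.2, -p.1.2.1] (by
      rw [det_fin_two_of]
      intro h
      exact hd (by linear_combination h + p.2)), by
    refine ⟨add_neg_cancel _, ?_⟩
    change det !![p.1.2.1, p.1.1; p.1.2.2, -p.1.2.1] = d
    rw [det_fin_two_of]
    linear_combination -p.2⟩
  left_inv g := by
    apply Subtype.ext
    apply Units.ext
    ext i j
    fin_cases i <;> fin_cases j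
    · rfl
    · rfl
    · rfl
    · exact neg_eq_of_add_eq_zero_right g.2.1
  right_inv p := rfl

/-- Every involution of `PGL₂(F)` outside `PSL₂(F)` has exactly two lifts of determinant a
given nonsquare `d`. -/
theorem card_traceless_eq_two_mul {F : Type*} [Field F] [Fintype F] [DecidableEq F]
    (hF : ringChar F ≠ 2) {d : F} (hd : ¬ IsSquare d) :
    Nat.card {g : GL (Fin 2) F // g.val 0 0 + g.val 1 1 = 0 ∧ g.val.det = d} =
      2 * Nat.card {t : PGL2 F // orderOf t = 2 ∧ t ∉ PSL2 F} := by
  have h2 : (2 : F) ≠ 0 := Ring.two_ne_zero hF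
  have hd0 : d ≠ 0 := by
    rintro rfl
    exact hd IsSquare.zero
  let f : {g : GL (Fin 2) F // g.val 0 0 + g.val 1 1 = 0 ∧ g.val.det = d} →
      {t : PGL2 F // orderOf t = 2 ∧ t ∉ PSL2 F} := fun g =>
    ⟨QuotientGroup.mk g.1, (PGL2_orderOf_mk_eq_two_iff h2 _).mpr g.2.1, by
      rw [mk_mem_PSL2_iff, g.2.2]
      exact hd⟩
  have hsurj : Function.Surjective f := by
    rintro ⟨t, ht, ht'⟩
    induction t using QuotientGroup.induction_on with
    | H g =>
      rw [PGL2_orderOf_mk_eq_two_iff h2] at ht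
      rw [mk_mem_PSL2_iff] at ht'
      have hg0 : g.val.det ≠ 0 := ((isUnit_iff_isUnit_det _).mp g.isUnit).ne_zero
      have hsq : IsSquare (d / g.val.det) := by
        rw [← quadraticChar_one_iff_isSquare (div_ne_zero hd0 hg0)]
        have h := congrArg (quadraticChar F) (div_mul_cancel₀ d hg0)
        rw [map_mul, quadraticChar_neg_one_iff_not_isSquare.mpr hd,
          quadraticChar_neg_one_iff_not_isSquare.mpr ht'] at h
        linarith
      obtain ⟨k, hk⟩ := hsq
      rw [div_eq_iff hg0] at hk
      have hdet : (k • g.val).det = d := by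
        rw [det_smul, Fintype.card_fin, hk, sq]
      refine ⟨⟨GeneralLinearGroup.mkOfDetNeZero (k • g.val) (hdet ▸ hd0), ?_, hdet⟩, ?_⟩
      · change k * g.val 0 0 + k * g.val 1 1 = 0
        rw [← mul_add, ht, mul_zero]
      · exact Subtype.ext (PGL2_mk_eq_mk_iff.mpr ⟨k, rfl⟩).symm
  have hfib (t) : Nat.card {g // f g = t} = 2 := by
    obtain ⟨g, rfl⟩ := hsurj t
    have hneg : (-g.1).val = (-1 : F) • g.1.val := by simp
    have hmem : (-g.1).val 0 0 + (-g.1).val 1 1 = 0 ∧ (-g.1).val.det = d := by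
      rw [hneg, det_smul, g.2.2]
      refine ⟨?_, by simp⟩
      simp only [Matrix.smul_apply, smul_eq_mul]
      linear_combination -g.2.1
    rw [Nat.card_eq_two_iff]
    refine ⟨⟨g, rfl⟩, ⟨⟨-g.1, hmem⟩,
      Subtype.ext (PGL2_mk_eq_mk_iff.mpr ⟨-1, hneg⟩).symm⟩, ?_, ?_⟩
    · intro h
      have h' : g.1.val = (-g.1).val := congrArg (fun x => x.1.1.val) h
      have hz : g.1.val = 0 := by
        rw [hneg] at h'
        ext i j
        have hij := congrFun₂ h' i j
        simp only [Matrix.smul_apply, smul_eq_mul] at hij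
        exact
          (mul_eq_zero.mp (show 2 * g.1.val i j = 0 by linear_combination hij)).resolve_left h2
      exact g.1.ne_zero hz
    · rw [Set.eq_univ_iff_forall]
      rintro ⟨h, hh⟩
      obtain ⟨k, hk⟩ := PGL2_mk_eq_mk_iff.mp (congrArg Subtype.val hh).symm
      have hk2 : k ^ 2 = 1 := by
        have hdet := h.2.2
        rw [hk, det_smul, g.2.2, Fintype.card_fin] at hdet
        exact mul_right_cancel₀ hd0 (by rw [hdet, one_mul])
      rcases (sq_eq_sq_iff_eq_or_eq_neg.mp (hk2.trans (one_pow 2).symm)) with rfl | rfl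
      · exact Or.inl (Subtype.ext (Subtype.ext (Units.ext (by simpa using hk))))
      · exact Or.inr (Subtype.ext (Subtype.ext (Units.ext (by simpa using hk))))
  have := Fintype.ofFinite {t : PGL2 F // orderOf t = 2 ∧ t ∉ PSL2 F}
  rw [← Nat.card_congr (Equiv.sigmaFiberEquiv f), Nat.card_sigma, Finset.sum_congr rfl
    (fun t _ => hfib t), Finset.sum_const, smul_eq_mul, Finset.card_univ, Nat.card_eq_fintype_card,
    mul_comm]

/-- For an odd prime power `q` with `q ≡ ε (mod 4)`, `ε = ±1`, the number of
involutions of `PGL₂(q)` lying outside `PSL₂(q)` is `q(q-ε)/2`. -/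
theorem card_outer_involutions_PGL2 (q : ℕ) (hq : IsPrimePow q) (hodd : Odd q)
    (ε : ℤ) (hε : ε = 1 ∨ ε = -1) (hmod : (q : ℤ) ≡ ε [ZMOD 4])
    (F : Type*) [Field F] [Fintype F] (hF : Fintype.card F = q) :
    2 * (Nat.card {t : PGL2 F // orderOf t = 2 ∧ t ∉ PSL2 F} : ℤ) = q * (q - ε) := by
  classical
  subst hF
  have hchar : ringChar F ≠ 2 := fun h =>
    Nat.not_even_iff_odd.mpr hodd (Nat.even_iff.mpr (FiniteField.even_card_of_char_two h))
  obtain ⟨d, hd⟩ := quadraticChar_exists_neg_one hchar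
  have hd0 : d ≠ 0 := by
    rintro rfl
    simp at hd
  have hneg : quadraticChar F (-1) = ε := by
    rw [quadraticChar_neg_one hchar]
    have hmod' : ((Fintype.card F : ℕ) : ℤ) % 4 = ε % 4 := hmod
    rcases hε with rfl | rfl
    · exact ZMod.χ₄_nat_one_mod_four (by omega)
    · exact ZMod.χ₄_nat_three_mod_four (by omega)
  have hcard := card_traceless_eq_two_mul hchar (quadraticChar_neg_one_iff_not_isSquare.mp hd)
  rw [Nat.card_congr (tracelessEquiv hd0), Nat.card_eq_fintype_card] at hcard
  have hquad := card_sq_add_mul_eq hchar (-d)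
  rw [hcard, ← neg_one_mul d, map_mul, hneg, hd] at hquad
  push_cast at hquad
  rw [hquad]
  ring
end
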